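/- Let n ≥ 2 be an integer, let Ω ⊆ ℝ² be open, and let U : Ω → (0,∞) be a smooth function satisfying ∂_t U = U_xx/(1+U_x²) - (n-1)/U on Ω, and assume U_xx ≤ 0 on Ω. Set Q := U². Then at every point of Ω where ∂_x³ Q = 0 and ∂_x² Q > 0 one has the parabolic inequality ∂_t ∂_x² Q ≤ (∂_x⁴ Q)/(1+U_x²). -/

import Mathlib

/-- `k`-th partial derivative in `x` of a function `U(x,t)`. -/
noncomputable def pdx (U : ℝ → ℝ → ℝ) (k : ℕ) (x t : ℝ) : ℝ :=
  deriv^[k] (fun x' => U x' t) x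

/-- Partial derivative in `t` of a function `U(x,t)`. -/
noncomputable def pdt (U : ℝ → ℝ → ℝ) (x t : ℝ) : ℝ :=
  deriv (fun t' => U x t') t

open Set Filter Topology

/-- The pointwise algebraic inequality: with `u, p, q, r` the value and the first three derivatives
of the profile, it says that `(1 / (1 + p²))_xx ≤ 0` where `(u²)_xxx = 0` and `(u²)_xx > 0`. -/
lemma snd_deriv_inv_nonpos {u p q r : ℝ} (hu : 0 < u) (hq : q ≤ 0)
    (h3 : 6 * p * q + 2 * u * r = 0) (h2 : 0 < 2 * p ^ 2 + 2 * u * q) :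
    -2 * (q ^ 2 + p * r) * (1 + p ^ 2) + 8 * p ^ 2 * q ^ 2 ≤ 0 := by
  have hr : r = -3 * p * q / u := by
    field_simp
    linarith
  have hfac : 0 ≤ q + (1 + p ^ 2) / u := by
    have : q + (1 + p ^ 2) / u = (u * q + 1 + p ^ 2) / u := by
      field_simp
      ring
    rw [this]
    exact div_nonneg (by linarith) hu.le
  have hprod : p ^ 2 * q * (q + (1 + p ^ 2) / u) ≤ 0 :=
    mul_nonpos_of_nonpos_of_nonneg (mul_nonpos_of_nonneg_of_nonpos (sq_nonneg p) hq) hfac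
  have : -2 * (q ^ 2 + p * r) * (1 + p ^ 2) + 8 * p ^ 2 * q ^ 2
      = -2 * q ^ 2 + 6 * (p ^ 2 * q * (q + (1 + p ^ 2) / u)) := by
    rw [hr]
    field_simp
    ring
  rw [this]
  nlinarith [sq_nonneg q]

lemma ContDiffOn.hasDerivAt_iterate_deriv {s : Set ℝ} (hs : IsOpen s) {u : ℝ → ℝ}
    (hu : ContDiffOn ℝ (⊤ : ℕ∞) u s) (k : ℕ) :
    ContDiffOn ℝ (⊤ : ℕ∞) (deriv^[k] u) s ∧
      ∀ y ∈ s, HasDerivAt (deriv^[k] u) (deriv^[k + 1] u y) y := by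
  have hsmooth : ContDiffOn ℝ (⊤ : ℕ∞) (deriv^[k] u) s := by
    induction k with
    | zero => exact hu
    | succ k ih =>
      rw [Function.iterate_succ_apply']
      exact ih.deriv_of_isOpen hs (by simp)
  refine ⟨hsmooth, fun y hy => ?_⟩
  rw [Function.iterate_succ_apply']
  exact ((hsmooth.differentiableOn (by simp)).differentiableAt (hs.mem_nhds hy)).hasDerivAt

/-- The inequality along a fixed time slice, where the time derivative of `u²` has been replaced by
the right-hand side of the evolution equation. -/
lemma iterate_deriv_sq_evolution_le {s : Set ℝ} (hs : IsOpen s) {u : ℝ → ℝ}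
    (hu : ContDiffOn ℝ (⊤ : ℕ∞) u s) (c : ℝ) {x : ℝ} (hx : x ∈ s) (hpos : 0 < u x)
    (hconc : deriv^[2] u x ≤ 0) (h3 : deriv^[3] (fun y => u y ^ 2) x = 0)
    (h2 : 0 < deriv^[2] (fun y => u y ^ 2) x) :
    deriv^[2] (fun y => 2 * u y * deriv^[2] u y / (1 + deriv^[1] u y ^ 2) - c) x ≤
      deriv^[4] (fun y => u y ^ 2) x / (1 + deriv^[1] u x ^ 2) := by
  have d0 := (hu.hasDerivAt_iterate_deriv hs 0).2
  have d1 := (hu.hasDerivAt_iterate_deriv hs 1).2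
  have d2 := (hu.hasDerivAt_iterate_deriv hs 2).2
  have d3 := (hu.hasDerivAt_iterate_deriv hs 3).2
  simp only [Nat.reduceAdd, zero_add, Function.iterate_zero, id] at d0 d1 d2 d3
  generalize deriv^[1] u = p at *
  generalize deriv^[2] u = q at *
  generalize deriv^[3] u = r at *
  generalize deriv^[4] u = w at *
  have e1 : EqOn (deriv^[1] fun y => u y ^ 2) (fun y => 2 * u y * p y) s := fun y hy => by
    refine HasDerivAt.deriv ?_
    refine ((d0 y hy).pow 2).congr_deriv ?_
    simp
  have e2 : EqOn (deriv^[2] fun y => u y ^ 2) (fun y => 2 * p y ^ 2 + 2 * u y * q y) s := by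
    rw [Function.iterate_succ_apply']
    refine (e1.deriv hs).trans fun y hy => HasDerivAt.deriv ?_
    refine (((d0 y hy).const_mul 2).mul (d1 y hy)).congr_deriv ?_
    ring
  have e3 : EqOn (deriv^[3] fun y => u y ^ 2) (fun y => 6 * p y * q y + 2 * u y * r y) s := by
    rw [Function.iterate_succ_apply']
    refine (e2.deriv hs).trans fun y hy => HasDerivAt.deriv ?_
    refine ((((d1 y hy).pow 2).const_mul 2).add
      (((d0 y hy).const_mul 2).mul (d2 y hy))).congr_deriv ?_
    simp
    ring
  have e4 : EqOn (deriv^[4] fun y => u y ^ 2)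
      (fun y => 6 * q y ^ 2 + 8 * p y * r y + 2 * u y * w y) s := by
    rw [Function.iterate_succ_apply']
    refine (e3.deriv hs).trans fun y hy => HasDerivAt.deriv ?_
    refine ((((d1 y hy).const_mul 6).mul (d2 y hy)).add
      (((d0 y hy).const_mul 2).mul (d3 y hy))).congr_deriv ?_
    ring
  have hne : ∀ y, 1 + p y ^ 2 ≠ 0 := fun y => by positivity
  have dA : ∀ y ∈ s, HasDerivAt (fun y => 1 + p y ^ 2) (2 * p y * q y) y := fun y hy => by
    refine (((d1 y hy).pow 2).const_add 1).congr_deriv ?_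
    simp
  have f1 : EqOn (deriv fun y => 2 * u y * q y / (1 + p y ^ 2) - c)
      (fun y => ((2 * p y * q y + 2 * u y * r y) * (1 + p y ^ 2)
        - 2 * u y * q y * (2 * p y * q y)) / (1 + p y ^ 2) ^ 2) s := fun y hy =>
    (((((d0 y hy).const_mul 2).mul (d2 y hy)).div (dA y hy) (hne y)).sub_const c).deriv
  have f2 : deriv^[2] (fun y => 2 * u y * q y / (1 + p y ^ 2) - c) x =
      (6 * q x ^ 2 + 8 * p x * r x + 2 * u x * w x) / (1 + p x ^ 2)
      + 2 * (6 * p x * q x + 2 * u x * r x) * (-(2 * p x * q x) / (1 + p x ^ 2) ^ 2)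
      + (2 * p x ^ 2 + 2 * u x * q x + 2) *
        ((-2 * (q x ^ 2 + p x * r x) * (1 + p x ^ 2) + 8 * p x ^ 2 * q x ^ 2)
          / (1 + p x ^ 2) ^ 3) := by
    refine (f1.deriv hs hx).trans (HasDerivAt.deriv ?_)
    have dN1 := (((d1 x hx).const_mul 2).mul (d2 x hx)).add
      (((d0 x hx).const_mul 2).mul (d3 x hx))
    have dN2 := (((d0 x hx).const_mul 2).mul (d2 x hx)).mul
      (((d1 x hx).const_mul 2).mul (d2 x hx))
    refine (((dN1.mul (dA x hx)).sub dN2).div ((dA x hx).pow 2)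
      (pow_ne_zero 2 (hne x))).congr_deriv ?_
    have := hne x
    simp only [Pi.mul_apply, Pi.add_apply, Pi.sub_apply, Pi.pow_apply]
    field_simp
    push_cast
    ring
  rw [e2 hx] at h2
  rw [e3 hx] at h3
  rw [f2, e4 hx]
  simp only at h2 h3 ⊢
  rw [h3]
  have hA := snd_deriv_inv_nonpos hpos hconc h3 h2
  have := mul_nonpos_of_nonneg_of_nonpos
    (show 0 ≤ 2 * p x ^ 2 + 2 * u x * q x + 2 by linarith)
    (div_nonpos_of_nonpos_of_nonneg hA (show 0 ≤ (1 + p x ^ 2) ^ 3 by positivity))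
  linarith

section Slices

variable {Ω : Set (ℝ × ℝ)} {f g : ℝ → ℝ → ℝ}

lemma isOpen_slice (hΩ : IsOpen Ω) (t : ℝ) : IsOpen {x : ℝ | (x, t) ∈ Ω} :=
  hΩ.preimage (by fun_prop)

lemma pdx_congr (hΩ : IsOpen Ω) (h : ∀ p ∈ Ω, f p.1 p.2 = g p.1 p.2) (k : ℕ) :
    ∀ p ∈ Ω, pdx f k p.1 p.2 = pdx g k p.1 p.2 := by
  rintro ⟨x, t⟩ hp
  suffices EqOn (deriv^[k] fun x' => f x' t) (deriv^[k] fun x' => g x' t)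
    {x : ℝ | (x, t) ∈ Ω} from this hp
  induction k with
  | zero => exact fun y hy => h (y, t) hy
  | succ k ih =>
    simp only [Function.iterate_succ_apply']
    exact ih.deriv (isOpen_slice hΩ t)

lemma hasDerivAt_fst_of_differentiableAt {F : ℝ × ℝ → ℝ} {x t : ℝ}
    (h : DifferentiableAt ℝ F (x, t)) :
    HasDerivAt (fun x' => F (x', t)) (fderiv ℝ F (x, t) (1, 0)) x :=
  h.hasFDerivAt.comp_hasDerivAt x ((hasDerivAt_id x).prodMk (hasDerivAt_const x t))

lemma hasDerivAt_snd_of_differentiableAt {F : ℝ × ℝ → ℝ} {x t : ℝ}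
    (h : DifferentiableAt ℝ F (x, t)) :
    HasDerivAt (fun t' => F (x, t')) (fderiv ℝ F (x, t) (0, 1)) t :=
  h.hasFDerivAt.comp_hasDerivAt t ((hasDerivAt_const t x).prodMk (hasDerivAt_id t))

lemma pdx_one_eq_fderiv (hΩ : IsOpen Ω) (hf : ContDiffOn ℝ (⊤ : ℕ∞) (Function.uncurry f) Ω) :
    ∀ p ∈ Ω, pdx f 1 p.1 p.2 = fderiv ℝ (Function.uncurry f) p (1, 0) := fun p hp =>
  (hasDerivAt_fst_of_differentiableAt
    ((hf.differentiableOn (by simp)).differentiableAt (hΩ.mem_nhds hp))).deriv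

lemma pdt_eq_fderiv (hΩ : IsOpen Ω) (hf : ContDiffOn ℝ (⊤ : ℕ∞) (Function.uncurry f) Ω) :
    ∀ p ∈ Ω, pdt f p.1 p.2 = fderiv ℝ (Function.uncurry f) p (0, 1) := fun p hp =>
  (hasDerivAt_snd_of_differentiableAt
    ((hf.differentiableOn (by simp)).differentiableAt (hΩ.mem_nhds hp))).deriv

lemma contDiffOn_pdx_one (hΩ : IsOpen Ω)
    (hf : ContDiffOn ℝ (⊤ : ℕ∞) (Function.uncurry f) Ω) :
    ContDiffOn ℝ (⊤ : ℕ∞) (Function.uncurry (pdx f 1)) Ω :=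
  ((hf.fderiv_of_isOpen hΩ (by simp)).clm_apply contDiffOn_const).congr
    (pdx_one_eq_fderiv hΩ hf)

lemma contDiffOn_pdt (hΩ : IsOpen Ω) (hf : ContDiffOn ℝ (⊤ : ℕ∞) (Function.uncurry f) Ω) :
    ContDiffOn ℝ (⊤ : ℕ∞) (Function.uncurry (pdt f)) Ω :=
  ((hf.fderiv_of_isOpen hΩ (by simp)).clm_apply contDiffOn_const).congr
    (pdt_eq_fderiv hΩ hf)

/-- Equality of mixed partial derivatives. -/
lemma pdt_pdx_one_comm (hΩ : IsOpen Ω)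
    (hf : ContDiffOn ℝ (⊤ : ℕ∞) (Function.uncurry f) Ω) :
    ∀ p ∈ Ω, pdt (pdx f 1) p.1 p.2 = pdx (pdt f) 1 p.1 p.2 := by
  intro p hp
  have hd : DifferentiableAt ℝ (fderiv ℝ (Function.uncurry f)) p :=
    ((hf.fderiv_of_isOpen (m := (⊤ : ℕ∞)) hΩ (by simp)).differentiableOn
      (by simp)).differentiableAt (hΩ.mem_nhds hp)
  have key (v w : ℝ × ℝ) : fderiv ℝ (fun z => fderiv ℝ (Function.uncurry f) z v) p w
      = fderiv ℝ (fderiv ℝ (Function.uncurry f)) p w v := by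
    rw [fderiv_clm_apply hd (differentiableAt_const v)]
    simp
  have hx : Function.uncurry (pdx f 1) =ᶠ[𝓝 p]
      fun z => fderiv ℝ (Function.uncurry f) z (1, 0) :=
    eventually_of_mem (hΩ.mem_nhds hp) (pdx_one_eq_fderiv hΩ hf)
  have ht : Function.uncurry (pdt f) =ᶠ[𝓝 p]
      fun z => fderiv ℝ (Function.uncurry f) z (0, 1) :=
    eventually_of_mem (hΩ.mem_nhds hp) (pdt_eq_fderiv hΩ hf)
  rw [pdt_eq_fderiv hΩ (contDiffOn_pdx_one hΩ hf) p hp,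
    pdx_one_eq_fderiv hΩ (contDiffOn_pdt hΩ hf) p hp, hx.fderiv_eq, ht.fderiv_eq, key, key]
  exact ((hf.contDiffAt (hΩ.mem_nhds hp)).isSymmSndFDerivAt
    (by simpa using WithTop.coe_le_coe.2 (le_top : (2 : ℕ∞) ≤ ⊤))) _ _

lemma pdt_pdx_two_comm (hΩ : IsOpen Ω)
    (hf : ContDiffOn ℝ (⊤ : ℕ∞) (Function.uncurry f) Ω) :
    ∀ p ∈ Ω, pdt (pdx f 2) p.1 p.2 = pdx (pdt f) 2 p.1 p.2 := fun p hp =>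
  (pdt_pdx_one_comm hΩ (contDiffOn_pdx_one hΩ hf) p hp).trans
    (pdx_congr hΩ (pdt_pdx_one_comm hΩ hf) 1 p hp)

end Slices

/-- If `U > 0` is smooth on an open `Ω ⊆ ℝ²`, solves the rotationally symmetric
MCF profile equation `∂_t U = U_xx/(1+U_x²) - (n-1)/U`, and is concave in `x`
(`U_xx ≤ 0`), then writing `Q = U²`, at every point of `Ω` where `∂_x³ Q = 0`
and `∂_x² Q > 0` one has `∂_t ∂_x² Q ≤ (∂_x⁴ Q)/(1+U_x²)`. -/
theorem Qxx_parabolic_inequality (n : ℕ) (hn : 2 ≤ n)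
    (Ω : Set (ℝ × ℝ)) (hΩ : IsOpen Ω) (U : ℝ → ℝ → ℝ)
    (hU : ContDiffOn ℝ (⊤ : ℕ∞) (Function.uncurry U) Ω)
    (hpos : ∀ p ∈ Ω, 0 < U p.1 p.2)
    (hPDE : ∀ p ∈ Ω, pdt U p.1 p.2 =
      pdx U 2 p.1 p.2 / (1 + (pdx U 1 p.1 p.2) ^ 2) - ((n : ℝ) - 1) / U p.1 p.2)
    (hconc : ∀ p ∈ Ω, pdx U 2 p.1 p.2 ≤ 0) :
    ∀ p ∈ Ω, pdx (fun x t => (U x t) ^ 2) 3 p.1 p.2 = 0 →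
      0 < pdx (fun x t => (U x t) ^ 2) 2 p.1 p.2 →
      pdt (fun x t => pdx (fun a b => (U a b) ^ 2) 2 x t) p.1 p.2 ≤
        pdx (fun x t => (U x t) ^ 2) 4 p.1 p.2 / (1 + (pdx U 1 p.1 p.2) ^ 2) := by
  rintro ⟨x, t⟩ hp h3 h2
  have hQ : ContDiffOn ℝ (⊤ : ℕ∞) (Function.uncurry fun a b => U a b ^ 2) Ω := hU.pow 2
  have hQt : ∀ p ∈ Ω, pdt (fun a b => U a b ^ 2) p.1 p.2 =
      2 * U p.1 p.2 * pdx U 2 p.1 p.2 / (1 + pdx U 1 p.1 p.2 ^ 2) - 2 * ((n : ℝ) - 1) := by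
    intro p hp
    have hd : HasDerivAt (fun t' => U p.1 t') (pdt U p.1 p.2) p.2 :=
      (hasDerivAt_snd_of_differentiableAt ((hU.differentiableOn (by simp)).differentiableAt
        (hΩ.mem_nhds hp))).differentiableAt.hasDerivAt
    have hne := (hpos p hp).ne'
    refine (hd.pow 2).deriv.trans ?_
    rw [hPDE p hp]
    field_simp
    push_cast
    ring
  refine ((pdt_pdx_two_comm hΩ hQ _ hp).trans (pdx_congr hΩ
    (g := fun a b => 2 * U a b * pdx U 2 a b / (1 + pdx U 1 a b ^ 2) - 2 * ((n : ℝ) - 1))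
    hQt 2 _ hp)).trans_le ?_
  have hu : ContDiffOn ℝ (⊤ : ℕ∞) (fun x' => U x' t) {x' : ℝ | (x', t) ∈ Ω} :=
    hU.comp (f := fun x' : ℝ => (x', t)) (by fun_prop) fun _ h => h
  exact iterate_deriv_sq_evolution_le (isOpen_slice hΩ t) hu _ hp (hpos _ hp) (hconc _ hp) h3 h2
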